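/- Let E be a real Banach space, let t₀ < t₁ be real numbers, set Δt := t₁ − t₀, and set m := (t₀ + t₁)/2. If f : ℝ → E is three times continuously differentiable on [t₀, t₁], then ‖(f(t₁) − f(t₀))/Δt − f'(m)‖ ≤ Δt^{3/2} · (∫_{t₀}^{t₁} ‖f'''(s)‖² ds)^{1/2}. -/

import Mathlib

theorem sq_intervalIntegral_le_mul_intervalIntegral_sq {a b : ℝ} (hab : a < b) {h : ℝ → ℝ}
    (hh : ContinuousOn h (Set.Icc a b)) :
    (∫ s in a..b, h s) ^ 2 ≤ (b - a) * ∫ s in a..b, h s ^ 2 := by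
  have hi : IntervalIntegrable h MeasureTheory.volume a b :=
    hh.intervalIntegrable_of_Icc hab.le
  have hi2 : IntervalIntegrable (fun s => h s ^ 2) MeasureTheory.volume a b :=
    (hh.pow 2).intervalIntegrable_of_Icc hab.le
  set A := ∫ s in a..b, h s with hA
  set B := ∫ s in a..b, h s ^ 2 with hB
  have hpos : 0 < b - a := sub_pos.2 hab
  have h0 : 0 ≤ ∫ s in a..b, ((b - a) * h s - A) ^ 2 :=
    intervalIntegral.integral_nonneg hab.le fun s _ => sq_nonneg _
  have h1 : ∫ s in a..b, ((b - a) * h s - A) ^ 2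
      = (b - a) ^ 2 * B - 2 * (b - a) * A * A + (b - a) * A ^ 2 := by
    have : ∀ s, ((b - a) * h s - A) ^ 2
        = (b - a) ^ 2 * h s ^ 2 - 2 * (b - a) * A * h s + A ^ 2 := fun s => by ring
    simp only [this]
    rw [intervalIntegral.integral_add ((hi2.const_mul _).sub (hi.const_mul _)) (by simp),
      intervalIntegral.integral_sub (hi2.const_mul _) (hi.const_mul _),
      intervalIntegral.integral_const_mul, intervalIntegral.integral_const_mul,
      intervalIntegral.integral_const, smul_eq_mul]
  rw [h1] at h0
  have h2 : 0 ≤ (b - a) * ((b - a) * B - A ^ 2) := by linarith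
  linarith [nonneg_of_mul_nonneg_right h2 hpos]

/-- The increments of a continuously differentiable function are bounded by the total integral
of the norm of its derivative. -/
theorem norm_sub_le_intervalIntegral_norm_derivWithin
    {E : Type*} [NormedAddCommGroup E] [NormedSpace ℝ E] [CompleteSpace E]
    {a b : ℝ} (hab : a < b) {g : ℝ → E} (hg : ContDiffOn ℝ 1 g (Set.Icc a b))
    {x y : ℝ} (hx : x ∈ Set.Icc a b) (hy : y ∈ Set.Icc a b) :
    ‖g y - g x‖ ≤ ∫ s in a..b, ‖derivWithin g (Set.Icc a b) s‖ := by
  wlog hxy : x ≤ y generalizing x y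
  · rw [norm_sub_rev]
    exact this hy hx (le_of_not_ge hxy)
  have hc : ContinuousOn (derivWithin g (Set.Icc a b)) (Set.Icc a b) :=
    hg.continuousOn_derivWithin (uniqueDiffOn_Icc hab) le_rfl
  have hsub : Set.Icc x y ⊆ Set.Icc a b := Set.Icc_subset_Icc hx.1 hy.2
  have hftc : ∫ s in x..y, derivWithin g (Set.Icc a b) s = g y - g x := by
    refine intervalIntegral.integral_eq_sub_of_hasDerivAt_of_le hxy
      (hg.continuousOn.mono hsub) (fun s hs => ?_) ((hc.mono hsub).intervalIntegrable_of_Icc hxy)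
    have hs' : s ∈ Set.Icc a b := hsub (Set.Ioo_subset_Icc_self hs)
    exact ((hg.differentiableOn one_ne_zero) s hs').hasDerivWithinAt.hasDerivAt
      (Icc_mem_nhds (hx.1.trans_lt hs.1) (hs.2.trans_le hy.2))
  rw [← hftc]
  exact (intervalIntegral.norm_integral_le_integral_norm hxy).trans
    (intervalIntegral.integral_mono_interval hx.1 hxy hy.2
      (Filter.Eventually.of_forall fun s => norm_nonneg _)
      (hc.norm.intervalIntegrable_of_Icc hab.le))


/-- Second-order (Crank–Nicolson, θ = 1/2) time remainder bound: if `f` is three times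
continuously differentiable on `[t₀, t₁]`, `Δt = t₁ − t₀` and `m = (t₀ + t₁)/2`, then
`‖(f(t₁) − f(t₀))/Δt − f'(m)‖ ≤ Δt^{3/2} · (∫_{t₀}^{t₁} ‖f'''(s)‖² ds)^{1/2}`. -/
theorem crank_nicolson_time_remainder_second_order
    {E : Type*} [NormedAddCommGroup E] [NormedSpace ℝ E] [CompleteSpace E]
    (t₀ t₁ : ℝ) (ht : t₀ < t₁)
    (f : ℝ → E) (hf : ContDiffOn ℝ 3 f (Set.Icc t₀ t₁)) :
    ‖(t₁ - t₀)⁻¹ • (f t₁ - f t₀) - derivWithin f (Set.Icc t₀ t₁) ((t₀ + t₁) / 2)‖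
      ≤ (t₁ - t₀) ^ ((3 : ℝ) / 2)
          * (∫ s in t₀..t₁,
              ‖derivWithin (derivWithin (derivWithin f (Set.Icc t₀ t₁)) (Set.Icc t₀ t₁))
                  (Set.Icc t₀ t₁) s‖ ^ 2)
            ^ ((1 : ℝ) / 2) := by
  set I := Set.Icc t₀ t₁ with hI
  have hu : UniqueDiffOn ℝ I := uniqueDiffOn_Icc ht
  have hconv : Convex ℝ I := convex_Icc t₀ t₁
  have hf₁ : ContDiffOn ℝ 2 (derivWithin f I) I := hf.derivWithin hu (by norm_num)
  have hf₂ : ContDiffOn ℝ 1 (derivWithin (derivWithin f I) I) I :=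
    hf₁.derivWithin hu (by norm_num)
  have hf₃ : ContinuousOn (derivWithin (derivWithin (derivWithin f I) I) I) I :=
    hf₂.continuousOn_derivWithin hu le_rfl
  have hCS := sq_intervalIntegral_le_mul_intervalIntegral_sq ht hf₃.norm
  set m := (t₀ + t₁) / 2 with hm
  have hmI : m ∈ I := ⟨by rw [hm]; linarith, by rw [hm]; linarith⟩
  have hb₂ : ∀ s ∈ I, ‖derivWithin (derivWithin f I) I s - derivWithin (derivWithin f I) I m‖
      ≤ ∫ s in t₀..t₁, ‖derivWithin (derivWithin (derivWithin f I) I) I s‖ := fun s hs =>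
    norm_sub_le_intervalIntegral_norm_derivWithin ht hf₂ hmI hs
  have hA0 : 0 ≤ ∫ s in t₀..t₁, ‖derivWithin (derivWithin (derivWithin f I) I) I s‖ :=
    intervalIntegral.integral_nonneg ht.le fun s _ => norm_nonneg _
  have hB0 : 0 ≤ ∫ s in t₀..t₁, ‖derivWithin (derivWithin (derivWithin f I) I) I s‖ ^ 2 :=
    intervalIntegral.integral_nonneg ht.le fun s _ => sq_nonneg _
  set A := ∫ s in t₀..t₁, ‖derivWithin (derivWithin (derivWithin f I) I) I s‖
  set B := ∫ s in t₀..t₁, ‖derivWithin (derivWithin (derivWithin f I) I) I s‖ ^ 2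
  set v := derivWithin f I m with hv
  set w := derivWithin (derivWithin f I) I m
  have hpos : 0 < t₁ - t₀ := sub_pos.2 ht
  have hb₁ : ∀ s ∈ I, ‖derivWithin f I s - v - (s - m) • w‖ ≤ A * (t₁ - t₀) := by
    intro s hs
    have hd : ∀ x ∈ I, HasDerivWithinAt (fun x => derivWithin f I x - v - (x - m) • w)
        (derivWithin (derivWithin f I) I x - w) I x := fun x hx => by
      refine ((((hf₁.differentiableOn two_ne_zero) x hx).hasDerivWithinAt.sub_const v).sub
        (((hasDerivWithinAt_id x I).sub_const m).smul_const w)).congr_deriv ?_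
      rw [one_smul]
    have := hconv.norm_image_sub_le_of_norm_hasDerivWithin_le hd hb₂ hmI hs
    simp only [← hv, sub_self, zero_smul, sub_zero] at this
    refine this.trans (mul_le_mul_of_nonneg_left ?_ hA0)
    rw [Real.norm_eq_abs, abs_le]
    constructor <;> linarith [hs.1, hs.2, hmI.1, hmI.2]
  have hb₀ : ‖f t₁ - f t₀ - (t₁ - t₀) • v‖ ≤ A * (t₁ - t₀) * (t₁ - t₀) := by
    have hd : ∀ x ∈ I, HasDerivWithinAt (fun x => f x - x • v - ((x - m) ^ 2 / 2) • w)
        (derivWithin f I x - v - (x - m) • w) I x := fun x hx => by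
      have hq : HasDerivWithinAt (fun x : ℝ => (x - m) ^ 2 / 2) (x - m) I x := by
        refine ((((hasDerivWithinAt_id x I).sub_const m).pow 2).div_const 2).congr_deriv ?_
        simp
      refine (((((hf.differentiableOn three_ne_zero) x hx).hasDerivWithinAt).sub
        ((hasDerivWithinAt_id x I).smul_const v)).sub (hq.smul_const w)).congr_deriv ?_
      rw [one_smul]
    have := hconv.norm_image_sub_le_of_norm_hasDerivWithin_le hd hb₁
      (Set.left_mem_Icc.2 ht.le) (Set.right_mem_Icc.2 ht.le)
    rw [Real.norm_of_nonneg hpos.le] at this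
    convert this using 2
    have hsq : (t₁ - m) ^ 2 / 2 = (t₀ - m) ^ 2 / 2 := by rw [hm]; ring
    rw [hsq, sub_smul]
    abel
  have hkey : ‖(t₁ - t₀)⁻¹ • (f t₁ - f t₀) - v‖ ≤ A * (t₁ - t₀) := by
    have : (t₁ - t₀)⁻¹ • (f t₁ - f t₀) - v
        = (t₁ - t₀)⁻¹ • (f t₁ - f t₀ - (t₁ - t₀) • v) := by
      rw [smul_sub _ (f t₁ - f t₀), inv_smul_smul₀ hpos.ne']
    rw [this, norm_smul, norm_inv, Real.norm_of_nonneg hpos.le, inv_mul_le_iff₀ hpos]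
    linarith
  have hA : A ≤ (t₁ - t₀) ^ ((1 : ℝ) / 2) * B ^ ((1 : ℝ) / 2) := by
    rw [← Real.mul_rpow hpos.le hB0, ← Real.sqrt_eq_rpow]
    exact Real.le_sqrt_of_sq_le hCS
  calc _ ≤ A * (t₁ - t₀) := hkey
    _ ≤ (t₁ - t₀) ^ ((1 : ℝ) / 2) * B ^ ((1 : ℝ) / 2) * (t₁ - t₀) :=
        mul_le_mul_of_nonneg_right hA hpos.le
    _ = _ := by
        rw [show (3 : ℝ) / 2 = 1 / 2 + 1 by norm_num, Real.rpow_add hpos, Real.rpow_one]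
        ring
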